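/- For every k ≥ 1 and any vertex s ∈ V, F_k(G) = F₁(G) · Σ_{h=0}^{k−1} (−1)^h Σ w(e₁)⋯w(e_h) · det M, where the inner sum is over all sets {e₁,…,e_h} of h distinct (unordered) edges of G together with all sets {x₁,…,x_{k−1−h}} of k−1−h distinct vertices of V, and M is the square submatrix of the Green's function G^{(s)} whose rows and columns are both indexed by the 2h endpoints of e₁,…,e_h together with x₁,…,x_{k−1−h} (with the convention that det M = 0 if these 2h + (k−1−h) indices are not pairwise distinct). -/

import Mathlib

open scoped Classical

/-- The weighted Laplacian of `w` on a finite vertex set. -/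
noncomputable def lap {V : Type*} [Fintype V] [DecidableEq V] (w : V → V → ℝ) :
    Matrix V V ℝ :=
  Matrix.of fun u v =>
    if u = v then ∑ x ∈ Finset.univ.filter (fun x => x ≠ u), w u x else -(w u v)

/-- The Green's function with Dirichlet boundary condition at `s`. -/
noncomputable def green {V : Type*} [Fintype V] [DecidableEq V]
    (w : V → V → ℝ) (s u v : V) : ℝ :=
  if hu : u = s then 0
  else if hv : v = s then 0
  else (((lap w).submatrix (Subtype.val : {x : V // x ≠ s} → V) Subtype.val)⁻¹)
      (⟨u, hu⟩ : {x : V // x ≠ s}) (⟨v, hv⟩ : {x : V // x ≠ s})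

/-- The weighted sum `F_k(G)` of `k`-component spanning forests of `G`. -/
noncomputable def forestSum {V : Type*} [Fintype V] [DecidableEq V]
    (w : V → V → ℝ) (hsym : ∀ u v, w u v = w v u) (G : SimpleGraph V) (k : ℕ) : ℝ :=
  ∑ F ∈ Finset.univ.filter (fun F : Finset (Sym2 V) =>
      (F : Set (Sym2 V)) ⊆ G.edgeSet ∧
      (SimpleGraph.fromEdgeSet (F : Set (Sym2 V))).IsAcyclic ∧
      Nat.card (SimpleGraph.fromEdgeSet (F : Set (Sym2 V))).ConnectedComponent = k),
    ∏ e ∈ F, Sym2.lift ⟨w, hsym⟩ e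

/-- The set of endpoints of a finite set of unordered edges. -/
def endpoints {V : Type*} [DecidableEq V] (Es : Finset (Sym2 V)) : Finset V :=
  Es.sup (Sym2.lift ⟨fun a b => ({a, b} : Finset V), fun a b => Finset.pair_comm a b⟩)

/-- `SpansFrom S B` states that every vertex can be reached from `B` along edges in `S`. -/
def SpansFrom {V : Type*} (S : Finset (Sym2 V)) (B : Finset V) : Prop :=
  ∀ C : Set V, (∀ b ∈ B, b ∈ C) → (∀ u v, s(u, v) ∈ S → u ∈ C → v ∈ C) → ∀ v, v ∈ C

namespace SpansFrom

variable {V : Type*} {S T : Finset (Sym2 V)} {A B : Finset V}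

lemma mono_left (h : SpansFrom S B) (hST : S ⊆ T) : SpansFrom T B :=
  fun C hB hC => h C hB fun u v huv => hC u v (hST huv)

lemma mono_right (h : SpansFrom S A) (hAB : A ⊆ B) : SpansFrom S B :=
  fun C hB hC => h C (fun b hb => hB b (hAB hb)) hC

lemma exists_edge [Fintype V] (h : SpansFrom S B) (hB : B ≠ Finset.univ) :
    ∃ u v, s(u, v) ∈ S ∧ u ∈ B ∧ v ∉ B := by
  by_contra! hcon
  exact hB (Finset.eq_univ_iff_forall.2 fun v => h B (fun b hb => hb) hcon v)

variable [DecidableEq V]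

/-- Edges with both endpoints in `B` may be dropped. -/
lemma sdiff (h : SpansFrom S B) (hT : ∀ e ∈ T, ∀ v ∈ e, v ∈ B) : SpansFrom (S \ T) B := by
  intro C hB hC
  refine h C hB fun u v huv hu => ?_
  by_cases he : s(u, v) ∈ T
  · exact hB v (hT _ he v (Sym2.mem_mk_right u v))
  · exact hC u v (Finset.mem_sdiff.2 ⟨huv, he⟩) hu

lemma erase (h : SpansFrom S B) {e : Sym2 V} (he : ∀ v ∈ e, v ∈ B) :
    SpansFrom (S.erase e) B := by
  have := h.sdiff (T := {e}) (by simpa using he)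
  rwa [Finset.sdiff_singleton_eq_erase] at this

/-- Vertices joined to `B` by an edge of `S` may be removed from a spanning set containing `B`. -/
lemma of_union (h : SpansFrom S (A ∪ B)) (hA : ∀ a ∈ A, a ∉ B → ∃ b ∈ B, s(b, a) ∈ S) :
    SpansFrom S B := by
  intro C hB hC
  refine h C (fun x hx => ?_) hC
  rcases Finset.mem_union.1 hx with hx | hx
  · by_cases hxB : x ∈ B
    · exact hB x hxB
    obtain ⟨b, hb, hba⟩ := hA x hx hxB
    exact hC b x hba (hB b hb)
  · exact hB x hx

lemma induction_step [Fintype V] (h : SpansFrom S B) {u v : V} (hu : u ∈ B) :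
    SpansFrom (S.erase s(u, v)) (insert v B) := by
  refine (h.mono_right (Finset.subset_insert v B)).erase fun x hx => ?_
  rcases Sym2.mem_iff.1 hx with rfl | rfl <;> simp [*]

lemma card_le [Fintype V] (h : SpansFrom S B) : Fintype.card V ≤ S.card + B.card := by
  induction hn : S.card generalizing S B with
  | zero =>
    by_cases hB : B = Finset.univ
    · simp [hB]
    · obtain ⟨u, v, huv, -⟩ := h.exists_edge hB
      simp_all
  | succ n ih =>
    by_cases hB : B = Finset.univ
    · simp [hB]
    · obtain ⟨u, v, huv, hu, hv⟩ := h.exists_edge hB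
      have := ih (h.induction_step (v := v) hu) (by rw [Finset.card_erase_of_mem huv, hn]; rfl)
      rw [Finset.card_insert_of_notMem hv] at this
      omega

lemma exists_subset [Fintype V] (h : SpansFrom S B) :
    ∃ T ⊆ S, SpansFrom T B ∧ T.card + B.card ≤ Fintype.card V := by
  induction hn : Fintype.card V - B.card generalizing B with
  | zero =>
    have hB : B = Finset.univ := by
      rw [← Finset.card_eq_iff_eq_univ]
      have := Finset.card_le_univ B
      omega
    exact ⟨∅, by simp, fun C hC _ v => hC v (by simp [hB]), by simp [hB]⟩
  | succ n ih =>
    have hB : B ≠ Finset.univ := by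
      rintro rfl
      simp at hn
    obtain ⟨u, v, huv, hu, hv⟩ := h.exists_edge hB
    have hc := Finset.card_insert_of_notMem hv
    obtain ⟨T, hTS, hT, hTc⟩ := ih (h.mono_right (Finset.subset_insert v B)) (by omega)
    refine ⟨insert s(u, v) T, ?_, ?_, ?_⟩
    · exact Finset.insert_subset huv hTS
    · intro C hBC hC
      refine hT C (fun b hb => ?_) fun x y hxy => hC x y (Finset.mem_insert_of_mem hxy)
      rcases Finset.mem_insert.1 hb with rfl | hb
      · exact hC u b (Finset.mem_insert_self _ _) (hBC u hu)
      · exact hBC b hb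
    · have := Finset.card_insert_le s(u, v) T
      omega

lemma exists_head [Fintype V] (h : SpansFrom S B) (hc : S.card + B.card = Fintype.card V) :
    ∃ σ : Sym2 V → V, Set.InjOn σ S ∧ ∀ e ∈ S, σ e ∈ e ∧ σ e ∉ B := by
  induction hn : S.card generalizing S B with
  | zero =>
    obtain rfl := Finset.card_eq_zero.1 hn
    exact ⟨fun e => e.out.1, by simp, by simp⟩
  | succ n ih =>
    have hB : B ≠ Finset.univ := by
      rintro rfl
      simp at hc
      simp [hc] at hn
    obtain ⟨u, v, huv, hu, hv⟩ := h.exists_edge hB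
    have hcB := Finset.card_insert_of_notMem hv
    have hcS := Finset.card_erase_of_mem huv
    obtain ⟨σ, hσ, hσ'⟩ := ih (h.induction_step (v := v) hu) (by omega) (by omega)
    have hne : ∀ e ∈ S, e ≠ s(u, v) → σ e ≠ v := fun e he hev heq =>
      (hσ' e (Finset.mem_erase.2 ⟨hev, he⟩)).2 (by simp [heq])
    refine ⟨Function.update σ s(u, v) v, ?_, ?_⟩
    · intro e he f hf hef
      by_cases h1 : e = s(u, v) <;> by_cases h2 : f = s(u, v)
      · rw [h1, h2]
      · subst h1
        rw [Function.update_self, Function.update_of_ne h2] at hef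
        exact absurd hef.symm (hne f hf h2)
      · subst h2
        rw [Function.update_self, Function.update_of_ne h1] at hef
        exact absurd hef (hne e he h1)
      · rw [Function.update_of_ne h2, Function.update_of_ne h1] at hef
        exact hσ (by simpa [h1] using he) (by simpa [h2] using hf) hef
    · intro e he
      by_cases h1 : e = s(u, v)
      · subst h1
        simp [hv]
      · rw [Function.update_of_ne h1]
        have := hσ' e (Finset.mem_erase.2 ⟨h1, he⟩)
        exact ⟨this.1, fun hb => this.2 (Finset.mem_insert_of_mem hb)⟩

end SpansFrom

lemma spansFrom_iff_reachable {V : Type*} {S : Finset (Sym2 V)} {B : Finset V} :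
    SpansFrom S B ↔
      ∀ v, ∃ b ∈ B, (SimpleGraph.fromEdgeSet (S : Set (Sym2 V))).Reachable b v := by
  constructor
  · intro h
    refine h {v | ∃ b ∈ B, (SimpleGraph.fromEdgeSet (S : Set (Sym2 V))).Reachable b v}
      (fun b hb => ⟨b, hb, .rfl⟩) ?_
    rintro u v huv ⟨b, hb, hbu⟩
    refine ⟨b, hb, ?_⟩
    by_cases hne : u = v
    · exact hne ▸ hbu
    · exact hbu.trans (SimpleGraph.Adj.reachable (by simp [huv, hne]))
  · intro h C hB hC v
    obtain ⟨b, hb, ⟨p⟩⟩ := h v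
    have := hB b hb
    clear hb
    induction p with
    | nil => exact this
    | cons hadj _ ih =>
      exact ih (hC _ _ (by simpa using (SimpleGraph.fromEdgeSet_adj _).1 hadj |>.1) this)

/-- A set of representatives of the connected components containing a given vertex. -/
lemma exists_component_representatives {V : Type*} [Fintype V] (S : Finset (Sym2 V)) (s : V) :
    ∃ R : Finset V, s ∈ R ∧ SpansFrom S R ∧
      R.card = Nat.card (SimpleGraph.fromEdgeSet (S : Set (Sym2 V))).ConnectedComponent ∧
      ∀ x ∈ R, ∀ y ∈ R, (SimpleGraph.fromEdgeSet (S : Set (Sym2 V))).Reachable x y → x = y := by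
  classical
  set H := SimpleGraph.fromEdgeSet (S : Set (Sym2 V)) with hH
  let r : H.ConnectedComponent → V := fun c =>
    if c = H.connectedComponentMk s then s else c.out
  have hr : ∀ c, H.connectedComponentMk (r c) = c := by
    intro c
    by_cases hc : c = H.connectedComponentMk s
    · simp [r, hc]
    · simp only [r, hc, if_false]
      exact Quot.out_eq c
  have hinj : Function.Injective r := fun c d hcd => by rw [← hr c, ← hr d, hcd]
  refine ⟨Finset.univ.image r, ?_, ?_, ?_, ?_⟩
  · exact Finset.mem_image.2 ⟨H.connectedComponentMk s, by simp, by simp [r]⟩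
  · rw [spansFrom_iff_reachable]
    exact fun v => ⟨r (H.connectedComponentMk v), by simp,
      SimpleGraph.ConnectedComponent.eq.1 (hr _)⟩
  · rw [Finset.card_image_of_injective _ hinj, Finset.card_univ, Nat.card_eq_fintype_card]
  · intro x hx y hy hxy
    obtain ⟨c, -, rfl⟩ := Finset.mem_image.1 hx
    obtain ⟨d, -, rfl⟩ := Finset.mem_image.1 hy
    replace hxy := SimpleGraph.ConnectedComponent.eq.2 hxy
    rw [hr, hr] at hxy
    rw [hxy]

lemma forest_iff {V : Type*} [Fintype V] (S : Finset (Sym2 V)) (hS : ∀ e ∈ S, ¬ e.IsDiag) (s : V) (k : ℕ) :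
    ((SimpleGraph.fromEdgeSet (S : Set (Sym2 V))).IsAcyclic ∧
      Nat.card (SimpleGraph.fromEdgeSet (S : Set (Sym2 V))).ConnectedComponent = k) ↔
    S.card + k = Fintype.card V ∧ ∃ R : Finset V, s ∈ R ∧ R.card = k ∧ SpansFrom S R := by
  classical
  set H := SimpleGraph.fromEdgeSet (S : Set (Sym2 V)) with hH
  have hedge : H.edgeSet = S := by
    rw [hH, SimpleGraph.edgeSet_fromEdgeSet]
    ext e
    simpa using hS e
  have hdel : ∀ e, H.deleteEdges {e} =
      SimpleGraph.fromEdgeSet ((S.erase e : Finset (Sym2 V)) : Set (Sym2 V)) := by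
    intro e
    rw [SimpleGraph.deleteEdges, hH]
    ext u v
    simp
  obtain ⟨R, hsR, hR, hRc, hRinj⟩ := exists_component_representatives S s
  rw [← hH] at hRc hRinj
  constructor
  · rintro ⟨hac, hk⟩
    refine ⟨?_, R, hsR, hRc.trans hk, hR⟩
    refine le_antisymm ?_ (by have := hR.card_le; omega)
    obtain ⟨T, hTS, hT, hTc⟩ := hR.exists_subset
    suffices T = S by rw [← this]; omega
    refine hTS.antisymm fun e he => ?_
    by_contra heT
    have hR' : SpansFrom (S.erase e) R := hT.mono_left fun f hf =>
      Finset.mem_erase.2 ⟨fun h => heT (h ▸ hf), hTS hf⟩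
    have hb := SimpleGraph.isAcyclic_iff_forall_isBridge.1 hac (hedge ▸ he : e ∈ H.edgeSet)
    rw [spansFrom_iff_reachable, ← hdel] at hR'
    induction e with | _ u v
    obtain ⟨b, hb1, hbu⟩ := hR' u
    obtain ⟨c, hc1, hcv⟩ := hR' v
    have hle : H.deleteEdges {s(u, v)} ≤ H := SimpleGraph.deleteEdges_le _
    have huv : H.Adj u v := by
      rw [← SimpleGraph.mem_edgeSet, hedge]
      exact he
    have hbc : b = c := hRinj b hb1 c hc1
      (((hbu.mono hle).trans huv.reachable).trans (hcv.mono hle).symm)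
    subst hbc
    exact (SimpleGraph.isBridge_iff.1 hb) (hbu.symm.trans hcv)
  · rintro ⟨hc, Q, -, hQc, hQ⟩
    constructor
    · rw [SimpleGraph.isAcyclic_iff_forall_isBridge]
      intro e he
      induction e with | _ u v
      rw [SimpleGraph.isBridge_iff]
      intro hreach
      rw [hedge] at he
      have he : s(u, v) ∈ S := he
      rw [hdel] at hreach
      have : SpansFrom (S.erase s(u, v)) Q := by
        rw [spansFrom_iff_reachable]
        set K := SimpleGraph.fromEdgeSet ((S.erase s(u, v) : Finset (Sym2 V)) : Set (Sym2 V))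
          with hK
        refine hQ {x | ∃ b ∈ Q, K.Reachable b x} (fun b hb => ⟨b, hb, .rfl⟩) ?_
        rintro x y hxy ⟨b, hb, hbx⟩
        refine ⟨b, hb, hbx.trans ?_⟩
        by_cases heq : s(x, y) = s(u, v)
        · rcases Sym2.eq_iff.1 heq with ⟨rfl, rfl⟩ | ⟨rfl, rfl⟩
          · exact hreach
          · exact hreach.symm
        · by_cases hne : x = y
          · rw [hne]
          · refine SimpleGraph.Adj.reachable ?_
            rw [hK, SimpleGraph.fromEdgeSet_adj]
            exact ⟨by simp [heq, hxy], hne⟩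
      have h1 := this.card_le
      rw [Finset.card_erase_of_mem he] at h1
      have := Finset.card_pos.2 ⟨_, he⟩
      omega
    · refine le_antisymm ?_ (by have := hR.card_le; omega)
      rw [← hQc, Nat.card_eq_fintype_card, ← Finset.card_univ]
      refine (Finset.card_le_card fun c _ => ?_).trans
        (Finset.card_image_le (s := Q) (f := H.connectedComponentMk))
      induction c using SimpleGraph.ConnectedComponent.ind with | _ v
      obtain ⟨b, hb, hbv⟩ := spansFrom_iff_reachable.1 hQ v
      exact Finset.mem_image.2 ⟨b, hb, SimpleGraph.ConnectedComponent.eq.2 hbv⟩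

namespace Matrix

variable {m R : Type*} [Fintype m] [DecidableEq m] [CommRing R]

lemma det_mul_eq_sum_fun {α : Type*} [Fintype α] (A : Matrix m α R) (B : Matrix α m R) :
    (A * B).det = ∑ g : m → α, (∏ i, A i (g i)) * (B.submatrix g id).det := by
  have h : A * B = fun i => ∑ a, A i a • B a := by
    ext i j
    simp [Matrix.mul_apply, Finset.sum_apply]
  rw [h]
  change (Matrix.detRowAlternating : (m → R) [⋀^m]→ₗ[R] R).toMultilinearMap
    (fun i => ∑ a, A i a • B a) = _
  rw [MultilinearMap.map_sum]
  refine Finset.sum_congr rfl fun g _ => ?_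
  rw [MultilinearMap.map_smul_univ]
  rfl

/-- The **Cauchy–Binet formula**, for a chosen enumeration `c S` of each subset `S`. -/
theorem det_mul_eq_sum_powersetCard {α : Type*} [Fintype α] [DecidableEq α]
    (A : Matrix m α R) (B : Matrix α m R)
    (c : Finset α → m → α)
    (hc : ∀ S : Finset α, S.card = Fintype.card m →
      Function.Injective (c S) ∧ Finset.univ.image (c S) = S) :
    (A * B).det = ∑ S ∈ Finset.powersetCard (Fintype.card m) Finset.univ,
      (A.submatrix id (c S)).det * (B.submatrix (c S) id).det := by
  rw [det_mul_eq_sum_fun, ← Finset.sum_filter_of_ne (p := Function.Injective)]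
  · rw [← Finset.sum_fiberwise_of_maps_to
      (t := Finset.powersetCard (Fintype.card m) Finset.univ) (g := fun g => Finset.univ.image g)]
    · refine Finset.sum_congr rfl fun S hS => ?_
      obtain ⟨hinj, him⟩ := hc S (Finset.mem_powersetCard.1 hS).2
      rw [← Matrix.det_transpose (A.submatrix id (c S)), Matrix.det_apply', Finset.sum_mul]
      symm
      refine Finset.sum_bij (fun π _ => c S ∘ π) ?_ ?_ ?_ ?_
      · intro π _
        simp only [Finset.mem_filter, Finset.mem_univ, true_and]
        refine ⟨hinj.comp π.injective, ?_⟩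
        rw [← Finset.image_image, Finset.image_univ_equiv, him]
      · intro π _ τ _ h
        ext i
        exact hinj (congrFun h i)
      · intro g hg
        simp only [Finset.mem_filter, Finset.mem_univ, true_and] at hg
        obtain ⟨hg, hgS⟩ := hg
        have : ∀ i, ∃ j, c S j = g i := by
          intro i
          have : g i ∈ Finset.univ.image (c S) := by
            rw [him, ← hgS]
            exact Finset.mem_image_of_mem _ (Finset.mem_univ i)
          simpa using this
        choose π hπ using this
        have hπi : Function.Injective π := fun i j hij => hg (by rw [← hπ, ← hπ, hij])
        exact ⟨Equiv.ofBijective π (Finite.injective_iff_bijective.1 hπi), Finset.mem_univ _,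
          funext hπ⟩
      · intro π _
        have : B.submatrix (c S ∘ π) id = (B.submatrix (c S) id).submatrix π id := rfl
        rw [this, Matrix.det_permute]
        simp only [Matrix.transpose_apply, Matrix.submatrix_apply, id, Function.comp]
        ring
    · intro g hg
      rw [Finset.mem_powersetCard]
      refine ⟨Finset.subset_univ _, ?_⟩
      rw [Finset.card_image_of_injective _ (Finset.mem_filter.1 hg).2, Finset.card_univ]
  · intro g _ hne i j hij
    by_contra hij'
    refine hne ?_
    rw [Matrix.det_zero_of_row_eq hij' (by ext k; simp [hij]), mul_zero]

/-- Jacobi's formula for complementary principal minors. -/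
lemma det_mul_det_inv_toSquareBlockProp (M : Matrix m m R) (hM : IsUnit M.det) (p : m → Prop)
    [DecidablePred p] :
    M.det * (M⁻¹.toSquareBlockProp p).det = (M.toSquareBlockProp fun i => ¬ p i).det := by
  let e := Equiv.sumCompl p
  have h1 : M * M⁻¹ = 1 := Matrix.mul_nonsing_inv M hM
  have h2 : M.submatrix e e * M⁻¹.submatrix e e = 1 := by
    rw [Matrix.submatrix_mul_equiv, h1, Matrix.submatrix_one_equiv]
  rw [← Matrix.det_submatrix_equiv_self e M]
  rw [← Matrix.fromBlocks_toBlocks (M.submatrix e e),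
    ← Matrix.fromBlocks_toBlocks (M⁻¹.submatrix e e), Matrix.fromBlocks_multiply,
    ← Matrix.fromBlocks_one, Matrix.fromBlocks_inj] at h2
  obtain ⟨h11, -, h21, -⟩ := h2
  have h3 : M.submatrix e e *
      fromBlocks (M⁻¹.submatrix e e).toBlocks₁₁ 0 (M⁻¹.submatrix e e).toBlocks₂₁ 1 =
      fromBlocks 1 (M.submatrix e e).toBlocks₁₂ 0 (M.submatrix e e).toBlocks₂₂ := by
    conv_lhs => rw [← Matrix.fromBlocks_toBlocks (M.submatrix e e)]
    rw [Matrix.fromBlocks_multiply, h11, h21]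
    simp
  have h4 := congrArg Matrix.det h3
  rw [Matrix.det_mul, Matrix.det_fromBlocks_zero₁₂, Matrix.det_fromBlocks_zero₂₁] at h4
  simp only [Matrix.det_one, mul_one, one_mul] at h4
  exact h4

end Matrix

/-- The oriented incidence matrix of the complete graph, for a chosen orientation. -/
noncomputable def orientedInc (R : Type*) [Ring R] {V : Type*} [DecidableEq V] :
    Matrix V (Sym2 V) R :=
  Matrix.of fun v e => (if v = e.out.1 then 1 else 0) - (if v = e.out.2 then 1 else 0)

section Incidence

variable {V : Type*} [DecidableEq V]

lemma orientedInc_mk (R : Type*) [Ring R] (u v : V) :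
    (∀ x, orientedInc R x s(u, v) = (if x = u then 1 else 0) - (if x = v then 1 else 0)) ∨
    (∀ x, orientedInc R x s(u, v) = (if x = v then 1 else 0) - (if x = u then 1 else 0)) := by
  have h : s((s(u, v) : Sym2 V).out.1, (s(u, v) : Sym2 V).out.2) = s(u, v) := Quot.out_eq _
  rcases Sym2.eq_iff.1 h with ⟨h1, h2⟩ | ⟨h1, h2⟩
  · left
    intro x
    simp only [orientedInc, Matrix.of_apply, h1, h2]
  · right
    intro x
    simp only [orientedInc, Matrix.of_apply, h1, h2]

variable [Fintype V]

lemma lap_eq_sum (w : V → V → ℝ) (hsym : ∀ u v, w u v = w v u) (E : Finset (Sym2 V))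
    (hE : ∀ u v, u ≠ v → s(u, v) ∉ E → w u v = 0) (u v : V) :
    lap w u v = ∑ e, (if e ∈ E then Sym2.lift ⟨w, hsym⟩ e else 0) *
      orientedInc ℝ u e * orientedInc ℝ v e := by
  have h0 : ∀ e, (if e ∈ E then Sym2.lift ⟨w, hsym⟩ e else 0) *
      orientedInc ℝ u e * orientedInc ℝ v e =
      Sym2.lift ⟨w, hsym⟩ e * orientedInc ℝ u e * orientedInc ℝ v e := by
    intro e
    split_ifs with he
    · rfl
    · induction e with | _ a b
      by_cases hab : a = b
      · subst hab
        rcases orientedInc_mk ℝ a a with h | h <;> simp [h]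
      · simp [hE a b hab he]
  rw [Finset.sum_congr rfl fun e _ => h0 e]
  by_cases huv : u = v
  · subst huv
    have h1 : ∀ e ∉ (Finset.univ.filter (fun x => x ≠ u)).image (fun x => s(u, x)),
        Sym2.lift ⟨w, hsym⟩ e * orientedInc ℝ u e * orientedInc ℝ u e = 0 := by
      intro e he
      induction e with | _ a b
      simp only [Finset.mem_image, Finset.mem_filter, Finset.mem_univ, true_and, not_exists,
        not_and] at he
      have ha := he a
      have hb := he b
      rcases orientedInc_mk ℝ a b with h | h <;> rw [h] <;> by_cases h1 : u = a <;>
        by_cases h2 : u = b <;> simp_all [Sym2.eq_swap]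
    rw [← Finset.sum_subset (Finset.subset_univ _) fun e _ he => h1 e he, Finset.sum_image]
    · simp only [lap, Matrix.of_apply, if_true]
      refine Finset.sum_congr rfl fun x hx => ?_
      have hx : x ≠ u := by simpa using hx
      rcases orientedInc_mk ℝ u x with h | h <;> simp [h, hx.symm]
    · intro x _ y _ hxy
      exact Sym2.congr_right.1 hxy
  · rw [Finset.sum_eq_single s(u, v)]
    · simp only [lap, Matrix.of_apply, huv, if_false]
      rcases orientedInc_mk ℝ u v with h | h <;> simp [h, huv, Ne.symm huv]
    · intro e _ he
      induction e with | _ a b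
      have h1 : ¬ (a = u ∧ b = v) := fun h => he (by rw [h.1, h.2])
      have h2 : ¬ (a = v ∧ b = u) := fun h => he (by rw [h.1, h.2, Sym2.eq_swap])
      rcases orientedInc_mk ℝ a b with h | h <;> rw [h, h] <;> by_cases h3 : u = a <;>
        by_cases h4 : u = b <;> by_cases h5 : v = a <;> by_cases h6 : v = b <;> simp_all
    · simp

variable {B : Finset V} {S : Finset (Sym2 V)} {c : {x // x ∉ B} → Sym2 V}

lemma isUnit_det_orientedInc (h : SpansFrom S B) (hc : Finset.univ.image c = S) :
    IsUnit ((orientedInc ℤ).submatrix (Subtype.val : {x // x ∉ B} → V) c).det := by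
  set M := (orientedInc ℤ).submatrix (Subtype.val : {x // x ∉ B} → V) c with hM
  have key : ∀ v, ∃ x : {x // x ∉ B} → ℤ, ∀ i : {x // x ∉ B},
      (M.mulVec x) i = if i.1 = v then 1 else 0 := by
    refine h {v | ∃ x : {x // x ∉ B} → ℤ, ∀ i : {x // x ∉ B},
      (M.mulVec x) i = if i.1 = v then 1 else 0} ?_ ?_
    · intro b hb
      refine ⟨0, fun i => ?_⟩
      have : i.1 ≠ b := fun h => i.2 (h ▸ hb)
      simp [this]
    · rintro u v huv ⟨x, hx⟩
      rw [← hc] at huv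
      obtain ⟨j, -, hj⟩ := Finset.mem_image.1 huv
      rcases orientedInc_mk ℤ u v with h | h
      · refine ⟨x - Pi.single j 1, fun i => ?_⟩
        rw [Matrix.mulVec_sub, Pi.sub_apply, hx, Matrix.mulVec_single_one]
        simp [hM, Matrix.col, hj, h]
      · refine ⟨x + Pi.single j 1, fun i => ?_⟩
        rw [Matrix.mulVec_add, Pi.add_apply, hx, Matrix.mulVec_single_one]
        simp [hM, Matrix.col, hj, h]
  choose X hX using key
  refine Matrix.isUnit_det_of_right_inverse (B := Matrix.of fun j i => X i.1 j) ?_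
  ext i k
  have := hX k.1 i
  rw [Matrix.one_apply, Matrix.mul_apply]
  simpa [Matrix.mulVec, dotProduct, Subtype.ext_iff] using this

lemma det_orientedInc_eq_zero (h : ¬ SpansFrom S B) (hc : Finset.univ.image c = S) :
    ((orientedInc ℝ).submatrix (Subtype.val : {x // x ∉ B} → V) c).det = 0 := by
  simp only [SpansFrom, not_forall] at h
  obtain ⟨C, hB, hC, v, hv⟩ := h
  rw [← Matrix.exists_vecMul_eq_zero_iff]
  let φ : V → ℝ := fun x => if x ∈ C then 0 else 1
  refine ⟨fun i => φ i.1, ?_, ?_⟩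
  · intro h0
    have := congrFun h0 ⟨v, fun hb => hv (hB v hb)⟩
    simp [φ, hv] at this
  · ext j
    have h1 : ∑ i : {x // x ∉ B}, φ i.1 * orientedInc ℝ i.1 (c j) =
        ∑ i, φ i * orientedInc ℝ i (c j) := by
      rw [← Finset.sum_subtype (Finset.univ.filter fun x => x ∉ B) (by simp)
        (fun i => φ i * orientedInc ℝ i (c j))]
      refine Finset.sum_subset (Finset.subset_univ _) fun x _ hx => ?_
      have hxB : x ∈ B := by simpa using hx
      simp [φ, hB x hxB]
    change ∑ i : {x // x ∉ B}, φ i.1 * orientedInc ℝ i.1 (c j) = 0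
    rw [h1]
    have hj : c j ∈ S := by
      rw [← hc]
      exact Finset.mem_image_of_mem _ (Finset.mem_univ j)
    generalize c j = e at hj
    induction e with | _ a b
    have hab : φ a = φ b := by
      have h1 := hC a b hj
      have h2 := hC b a (by rwa [Sym2.eq_swap])
      have h3 : a ∈ C ↔ b ∈ C := ⟨h1, h2⟩
      simp [φ, h3]
    rcases orientedInc_mk ℝ a b with h | h <;> simp [h, mul_sub, hab]

lemma det_orientedInc_sq (hc : Finset.univ.image c = S) :
    ((orientedInc ℝ).submatrix (Subtype.val : {x // x ∉ B} → V) c).det ^ 2 =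
      if SpansFrom S B then 1 else 0 := by
  split_ifs with h
  · have h1 := isUnit_det_orientedInc h hc
    have h2 : (orientedInc ℝ).submatrix (Subtype.val : {x // x ∉ B} → V) c =
        (Int.castRingHom ℝ).mapMatrix
          ((orientedInc ℤ).submatrix (Subtype.val : {x // x ∉ B} → V) c) := by
      ext i j
      simp [orientedInc]
    rw [h2, ← RingHom.map_det, ← map_pow, Int.isUnit_sq h1, map_one]
  · rw [det_orientedInc_eq_zero h hc]
    simp

end Incidence

/-- The determinant of the Laplacian with the rows and columns in `B` deleted. -/
noncomputable def lapMinor {V : Type*} [Fintype V] [DecidableEq V] (w : V → V → ℝ)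
    (B : Finset V) : ℝ :=
  ((lap w).submatrix (Subtype.val : {x // x ∉ B} → V) Subtype.val).det

section Minors

variable {V : Type*} [Fintype V] [DecidableEq V]

/-- The **matrix-tree theorem** for principal minors of the Laplacian. -/
theorem lapMinor_eq_sum (w : V → V → ℝ) (hsym : ∀ u v, w u v = w v u) (E : Finset (Sym2 V))
    (hE : ∀ u v, u ≠ v → s(u, v) ∉ E → w u v = 0) (B : Finset V) :
    lapMinor w B = ∑ S ∈ E.powerset with (S.card + B.card = Fintype.card V ∧ SpansFrom S B),
      ∏ e ∈ S, Sym2.lift ⟨w, hsym⟩ e := by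
  have hcard : Fintype.card {x // x ∉ B} + B.card = Fintype.card V := by
    rw [Fintype.card_subtype_compl, Fintype.card_coe]
    exact Nat.sub_add_cancel (Finset.card_le_univ B)
  have hex : ∀ S : Finset (Sym2 V), ∃ c : {x // x ∉ B} → Sym2 V,
      S.card = Fintype.card {x // x ∉ B} →
        Function.Injective c ∧ Finset.univ.image c = S := by
    intro S
    by_cases hS : S.card = Fintype.card {x // x ∉ B}
    · have f : {x // x ∉ B} ≃ S := Fintype.equivOfCardEq (by rw [Fintype.card_coe, hS])
      refine ⟨fun i => (f i).1, fun _ => ⟨Subtype.val_injective.comp f.injective, ?_⟩⟩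
      ext e
      simp only [Finset.mem_image, Finset.mem_univ, true_and]
      exact ⟨fun ⟨i, hi⟩ => hi ▸ (f i).2, fun he => ⟨f.symm ⟨e, he⟩, by simp⟩⟩
    · exact ⟨fun i => s(i.1, i.1), fun h => absurd h hS⟩
  choose c hc using hex
  let a : Sym2 V → ℝ := fun e => if e ∈ E then Sym2.lift ⟨w, hsym⟩ e else 0
  let N : Matrix {x // x ∉ B} (Sym2 V) ℝ := (orientedInc ℝ).submatrix Subtype.val id
  have hfac : (lap w).submatrix (Subtype.val : {x // x ∉ B} → V) Subtype.val =
      (Matrix.of fun i e => a e * N i e) * N.transpose := by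
    ext i j
    rw [Matrix.submatrix_apply, lap_eq_sum w hsym E hE, Matrix.mul_apply]
    rfl
  rw [lapMinor, hfac, Matrix.det_mul_eq_sum_powersetCard _ _ c hc]
  symm
  have hterm : ∀ S ∈ Finset.powersetCard (Fintype.card {x // x ∉ B}) (Finset.univ),
      ((Matrix.of fun i e => a e * N i e).submatrix id (c S)).det *
        (N.transpose.submatrix (c S) id).det =
      (∏ e ∈ S, a e) * if SpansFrom S B then 1 else 0 := by
    intro S hS
    obtain ⟨hinj, him⟩ := hc S (Finset.mem_powersetCard.1 hS).2
    have h1 : (Matrix.of fun i e => a e * N i e).submatrix id (c S) =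
        Matrix.of fun i j => a (c S j) * (N.submatrix id (c S)) i j := rfl
    have h2 : N.transpose.submatrix (c S) id = (N.submatrix id (c S)).transpose := rfl
    have h3 : ∏ j, a (c S j) = ∏ e ∈ S, a e := by
      conv_rhs => rw [← him]
      rw [Finset.prod_image (hinj.injOn)]
    rw [h1, h2, Matrix.det_mul_row, Matrix.det_transpose, h3, mul_assoc, ← sq,
      ← det_orientedInc_sq him]
    rfl
  refine Finset.sum_subset_zero_on_sdiff ?_ ?_ ?_
  · intro S hS
    simp only [Finset.mem_filter] at hS
    rw [Finset.mem_powersetCard]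
    exact ⟨Finset.subset_univ _, by omega⟩
  · intro S hS
    rw [Finset.mem_sdiff] at hS
    rw [hterm S hS.1]
    split_ifs with hsp
    · have hSE : ¬ S ⊆ E := by
        intro hSE
        refine hS.2 ?_
        have := (Finset.mem_powersetCard.1 hS.1).2
        simp only [Finset.mem_filter, Finset.mem_powerset]
        exact ⟨hSE, by omega, hsp⟩
      obtain ⟨e, heS, heE⟩ := Finset.not_subset.1 hSE
      rw [Finset.prod_eq_zero heS (by simp [a, heE]), zero_mul]
    · simp
  · intro S hS
    simp only [Finset.mem_filter, Finset.mem_powerset] at hS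
    obtain ⟨hSE, hSc, hsp⟩ := hS
    rw [hterm S (Finset.mem_powersetCard.2 ⟨Finset.subset_univ _, by omega⟩), if_pos hsp, mul_one]
    exact Finset.prod_congr rfl fun e he => by simp [a, hSE he]

lemma forestSum_eq_sum (w : V → V → ℝ) (hsym : ∀ u v, w u v = w v u) (G : SimpleGraph V)
    (E : Finset (Sym2 V)) (hE : ∀ e, e ∈ E ↔ e ∈ G.edgeSet) (s : V) (k : ℕ) :
    forestSum w hsym G k = ∑ S ∈ E.powerset with (S.card + k = Fintype.card V ∧
        ∃ R : Finset V, s ∈ R ∧ R.card = k ∧ SpansFrom S R),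
      ∏ e ∈ S, Sym2.lift ⟨w, hsym⟩ e := by
  rw [forestSum]
  refine Finset.sum_congr ?_ fun _ _ => rfl
  ext S
  simp only [Finset.mem_filter, Finset.mem_univ, true_and, Finset.mem_powerset]
  have hsub : (S : Set (Sym2 V)) ⊆ G.edgeSet ↔ S ⊆ E :=
    ⟨fun h e he => (hE e).2 (h he), fun h e he => (hE e).1 (h he)⟩
  rw [hsub]
  refine and_congr_right fun hS => forest_iff S (fun e he => ?_) s k
  exact G.not_isDiag_of_mem_edgeSet ((hE e).1 (hS he))

lemma forestSum_one (w : V → V → ℝ) (hsym : ∀ u v, w u v = w v u) (G : SimpleGraph V)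
    (E : Finset (Sym2 V)) (hE : ∀ e, e ∈ E ↔ e ∈ G.edgeSet)
    (hw : ∀ u v, u ≠ v → s(u, v) ∉ E → w u v = 0) (s : V) :
    forestSum w hsym G 1 = lapMinor w {s} := by
  rw [forestSum_eq_sum w hsym G E hE s, lapMinor_eq_sum w hsym E hw]
  refine Finset.sum_congr (Finset.filter_congr fun S _ => ?_) fun _ _ => rfl
  rw [Finset.card_singleton]
  refine and_congr_right fun _ => ⟨?_, fun h => ⟨{s}, by simp, by simp, h⟩⟩
  rintro ⟨R, hs, hR, h⟩
  obtain ⟨x, rfl⟩ := Finset.card_eq_one.1 hR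
  rwa [Finset.mem_singleton.1 hs]

lemma lapMinor_singleton_pos (w : V → V → ℝ) (hsym : ∀ u v, w u v = w v u)
    (G : SimpleGraph V) (E : Finset (Sym2 V)) (hE : ∀ e, e ∈ E ↔ e ∈ G.edgeSet)
    (hw : ∀ u v, u ≠ v → s(u, v) ∉ E → w u v = 0)
    (hpos : ∀ e ∈ E, 0 < Sym2.lift ⟨w, hsym⟩ e) (hG : G.Connected) (s : V) :
    0 < lapMinor w {s} := by
  classical
  rw [lapMinor_eq_sum w hsym E hw]
  have hp : ∀ S ⊆ E, 0 < ∏ e ∈ S, Sym2.lift ⟨w, hsym⟩ e := fun S hS =>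
    Finset.prod_pos fun e he => hpos e (hS he)
  refine Finset.sum_pos (fun S hS => hp S ?_) ?_
  · simp only [Finset.mem_filter, Finset.mem_powerset] at hS
    exact hS.1
  · obtain ⟨T, hTG, hT⟩ := hG.exists_isTree_le
    refine ⟨T.edgeFinset, ?_⟩
    simp only [Finset.mem_filter, Finset.mem_powerset, Finset.card_singleton]
    refine ⟨fun e he => ?_, hT.card_edgeFinset, ?_⟩
    · rw [SimpleGraph.mem_edgeFinset] at he
      exact (hE e).2 (SimpleGraph.edgeSet_mono hTG he)
    · rw [spansFrom_iff_reachable]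
      intro v
      refine ⟨s, by simp, ?_⟩
      rw [SimpleGraph.coe_edgeFinset, SimpleGraph.fromEdgeSet_edgeSet]
      exact hT.1 s v

/-- Principal minors of the Green's function are ratios of minors of the Laplacian. -/
lemma lapMinor_mul_det_green (w : V → V → ℝ) (s : V) (h : lapMinor w {s} ≠ 0) (A : Finset V) :
    lapMinor w {s} * (Matrix.of fun a b : {x : V // x ∈ A} => green w s a b).det =
      if s ∈ A then 0 else lapMinor w (insert s A) := by
  split_ifs with hs
  · rw [Matrix.det_eq_zero_of_row_eq_zero ⟨s, hs⟩ (fun j => by simp [green]), mul_zero]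
  · set M := (lap w).submatrix (Subtype.val : {x : V // x ≠ s} → V) Subtype.val with hM
    have h1 : lapMinor w {s} = M.det := by
      rw [lapMinor, ← Matrix.det_submatrix_equiv_self
        (Equiv.subtypeEquivRight (p := fun x => x ≠ s) (q := fun x => x ∉ ({s} : Finset V))
          (by simp))]
      rfl
    have h2 := Matrix.det_mul_det_inv_toSquareBlockProp M
      (isUnit_iff_ne_zero.2 (h1 ▸ h)) (fun x => x.1 ∈ A)
    rw [h1]
    have hne : ∀ x ∈ A, x ≠ s := fun x hx hxs => hs (hxs ▸ hx)
    let e1 : {x : V // x ∈ A} ≃ {x : {x : V // x ≠ s} // x.1 ∈ A} :=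
      ⟨fun x => ⟨⟨x.1, hne x.1 x.2⟩, x.2⟩, fun x => ⟨x.1.1, x.2⟩, fun _ => rfl, fun _ => rfl⟩
    let e2 : {x : V // x ∉ insert s A} ≃ {x : {x : V // x ≠ s} // ¬ x.1 ∈ A} :=
      ⟨fun x => ⟨⟨x.1, fun h => x.2 (by simp [h])⟩, fun h => x.2 (by simp [h])⟩,
        fun x => ⟨x.1.1, by simp [x.1.2, x.2]⟩, fun _ => rfl, fun _ => rfl⟩
    have h3 : (Matrix.of fun a b : {x : V // x ∈ A} => green w s a b).det =
        (M⁻¹.toSquareBlockProp fun x => x.1 ∈ A).det := by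
      rw [← Matrix.det_submatrix_equiv_self e1]
      congr 1
      ext a b
      simp only [Matrix.of_apply, green, hne a.1 a.2, hne b.1 b.2, dif_neg, not_false_iff]
      rfl
    have h4 : lapMinor w (insert s A) = (M.toSquareBlockProp fun x => ¬ x.1 ∈ A).det := by
      rw [← Matrix.det_submatrix_equiv_self e2]
      rfl
    rw [h3, h4, h2]

end Minors

section Endpoints

variable {V : Type*} [DecidableEq V]

lemma mem_endpoints {S : Finset (Sym2 V)} {v : V} : v ∈ endpoints S ↔ ∃ e ∈ S, v ∈ e := by
  rw [endpoints, Finset.mem_sup]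
  refine exists_congr fun e => and_congr_right fun _ => ?_
  induction e with | _ a b
  simp

lemma card_endpoints_le (S : Finset (Sym2 V)) : (endpoints S).card ≤ 2 * S.card := by
  rw [endpoints, Finset.sup_eq_biUnion, mul_comm]
  refine Finset.card_biUnion_le_card_mul _ _ _ fun e _ => ?_
  induction e with | _ a b
  exact Finset.card_le_two

lemma spansFrom_endpoints_iff {F S : Finset (Sym2 V)} (hSF : S ⊆ F) {σ : Sym2 V → V}
    (hσ : ∀ e ∈ S, σ e ∈ e) (X : Finset V) (s : V) :
    SpansFrom F (insert s (endpoints S ∪ X)) ↔ SpansFrom F (insert s (X ∪ S.image σ)) := by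
  constructor
  · intro h
    refine SpansFrom.of_union (A := endpoints S) (h.mono_right ?_) ?_
    · intro x hx
      simp only [Finset.mem_insert, Finset.mem_union] at hx ⊢
      tauto
    · intro a ha haX
      obtain ⟨e, he, hae⟩ := mem_endpoints.1 ha
      have hmem : σ e ∈ insert s (X ∪ S.image σ) := by
        simp only [Finset.mem_insert, Finset.mem_union, Finset.mem_image]
        exact Or.inr (Or.inr ⟨e, he, rfl⟩)
      have hea : σ e ≠ a := fun h => haX (h ▸ hmem)
      refine ⟨σ e, hmem, ?_⟩
      rw [← (Sym2.mem_and_mem_iff hea).1 ⟨hσ e he, hae⟩]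
      exact hSF he
  · intro h
    refine h.mono_right (Finset.insert_subset_insert s ?_)
    intro x hx
    simp only [Finset.mem_union, Finset.mem_image] at hx ⊢
    rcases hx with hx | ⟨e, he, rfl⟩
    · exact Or.inr hx
    · exact Or.inl (mem_endpoints.2 ⟨e, he, hσ e he⟩)

variable [Fintype V]

open Classical in
/-- The signed count of choices of edges of `F` and vertices which span `F` detects forests. -/
lemma sum_neg_one_pow_card_eq_ite (F : Finset (Sym2 V)) (s : V) (k : ℕ) (hk : 1 ≤ k)
    (hF : F.card + k = Fintype.card V) :
    ∑ S ∈ F.powerset, ∑ X : Finset V with (S.card + X.card + 1 = k ∧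
        SpansFrom F (insert s (endpoints S ∪ X))), (-1 : ℤ) ^ S.card =
      if ∃ R : Finset V, s ∈ R ∧ R.card = k ∧ SpansFrom F R then 1 else 0 := by
  have hlow : ∀ Y : Finset V, SpansFrom F (insert s Y) → k ≤ (insert s Y).card := fun Y hY => by
    have := hY.card_le
    omega
  split_ifs with hR
  · obtain ⟨R, hsR, hRk, hR⟩ := hR
    obtain ⟨σ, hinj, hσ⟩ := hR.exists_head (by omega)
    have hreindex : ∀ S ∈ F.powerset,
        ∑ X : Finset V with (S.card + X.card + 1 = k ∧
          SpansFrom F (insert s (endpoints S ∪ X))), (-1 : ℤ) ^ S.card =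
        ∑ Y : Finset V with ((Y.card + 1 = k ∧ SpansFrom F (insert s Y)) ∧ S.image σ ⊆ Y),
          (-1 : ℤ) ^ S.card := by
      intro S hS
      rw [Finset.mem_powerset] at hS
      have hcS : (S.image σ).card = S.card :=
        Finset.card_image_of_injOn (hinj.mono (by exact_mod_cast hS))
      have hdisj : ∀ X : Finset V, S.card + X.card + 1 = k →
          SpansFrom F (insert s (X ∪ S.image σ)) →
          Disjoint X (S.image σ) ∧ (X ∪ S.image σ).card + 1 = k := by
        intro X hX hsp
        have h1 := hlow _ hsp
        have h2 := Finset.card_insert_le s (X ∪ S.image σ)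
        have h3 := Finset.card_union_le X (S.image σ)
        refine ⟨Finset.card_union_eq_card_add_card.1 ?_, ?_⟩ <;> omega
      have hspan := fun X => spansFrom_endpoints_iff hS (fun e he => (hσ e (hS he)).1) X s
      refine Finset.sum_bij' (fun X _ => X ∪ S.image σ) (fun Y _ => Y \ S.image σ) ?_ ?_ ?_ ?_ ?_
      · intro X hX
        simp only [Finset.mem_filter, Finset.mem_univ, true_and, hspan] at hX ⊢
        exact ⟨⟨(hdisj X hX.1 hX.2).2, hX.2⟩, Finset.subset_union_right⟩
      · intro Y hY
        simp only [Finset.mem_filter, Finset.mem_univ, true_and, hspan] at hY ⊢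
        have h1 := Finset.card_sdiff_add_card_eq_card hY.2
        rw [Finset.sdiff_union_of_subset hY.2]
        exact ⟨by omega, hY.1.2⟩
      · intro X hX
        simp only [Finset.mem_filter, Finset.mem_univ, true_and, hspan] at hX
        exact Finset.union_sdiff_cancel_right (hdisj X hX.1 hX.2).1
      · intro Y hY
        simp only [Finset.mem_filter, Finset.mem_univ, true_and] at hY
        exact Finset.sdiff_union_of_subset hY.2
      · exact fun _ _ => rfl
    have hswap : ∀ (S : Finset (Sym2 V)) (Y : Finset V),
        S ∈ F.powerset ∧ Y ∈ Finset.univ.filter (fun Y : Finset V =>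
          (Y.card + 1 = k ∧ SpansFrom F (insert s Y)) ∧ S.image σ ⊆ Y) ↔
        S ∈ (F.filter fun e => σ e ∈ Y).powerset ∧ Y ∈ Finset.univ.filter (fun Y : Finset V =>
          Y.card + 1 = k ∧ SpansFrom F (insert s Y)) := by
      intro S Y
      have h1 : S ⊆ F.filter (fun e => σ e ∈ Y) ↔ S ⊆ F ∧ S.image σ ⊆ Y := by
        rw [Finset.image_subset_iff]
        simp only [Finset.subset_iff, Finset.mem_filter]
        exact forall₂_and
      simp only [Finset.mem_powerset, Finset.mem_filter, Finset.mem_univ, true_and, h1]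
      tauto
    rw [Finset.sum_congr rfl hreindex, Finset.sum_comm' hswap]
    simp_rw [Finset.sum_powerset_neg_one_pow_card]
    rw [Finset.sum_eq_single (R.erase s)]
    · rw [if_pos]
      rw [Finset.filter_eq_empty_iff]
      exact fun e he h => (hσ e he).2 (Finset.mem_of_mem_erase h)
    · intro Y hY hne
      rw [if_neg]
      intro hemp
      simp only [Finset.mem_filter, Finset.mem_univ, true_and] at hY
      rw [Finset.filter_eq_empty_iff] at hemp
      have hsY : s ∉ Y := by
        intro hsY
        have := hlow Y hY.2
        rw [Finset.insert_eq_of_mem hsY] at this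
        omega
      have himg : F.image σ ∪ R = Finset.univ := by
        rw [← Finset.card_eq_iff_eq_univ, Finset.card_union_of_disjoint,
          Finset.card_image_of_injOn hinj]
        · omega
        · rw [Finset.disjoint_left]
          intro x hx
          obtain ⟨e, he, rfl⟩ := Finset.mem_image.1 hx
          exact (hσ e he).2
      refine hne (Finset.eq_of_subset_of_card_le (fun y hy => ?_) ?_)
      · rw [Finset.mem_erase]
        refine ⟨fun h => hsY (h ▸ hy), ?_⟩
        have h1 : y ∈ F.image σ ∪ R := himg ▸ Finset.mem_univ y
        rcases Finset.mem_union.1 h1 with h1 | h1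
        · obtain ⟨e, he, rfl⟩ := Finset.mem_image.1 h1
          exact absurd hy (hemp he)
        · exact h1
      · rw [Finset.card_erase_of_mem hsR]
        omega
    · intro h
      refine absurd ?_ h
      simp only [Finset.mem_filter, Finset.mem_univ, true_and, Finset.insert_erase hsR,
        Finset.card_erase_of_mem hsR]
      exact ⟨by omega, hR⟩
  · refine Finset.sum_eq_zero fun S hS => Finset.sum_eq_zero fun X hX => ?_
    rw [Finset.mem_powerset] at hS
    simp only [Finset.mem_filter, Finset.mem_univ, true_and] at hX
    have h1 := (spansFrom_endpoints_iff hS (fun e _ => Sym2.out_fst_mem e) X s).1 hX.2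
    refine absurd ⟨_, Finset.mem_insert_self s _, ?_, h1⟩ hR
    have h2 := hlow _ h1
    have h3 := Finset.card_insert_le s (X ∪ S.image fun e => e.out.1)
    have h4 := Finset.card_union_le X (S.image fun e => e.out.1)
    have h5 : (S.image fun e => e.out.1).card ≤ S.card := Finset.card_image_le
    omega

open Classical in
/-- The contribution of a choice of edges and vertices, as a sum over edge sets. -/
lemma ite_lapMinor_eq_sum (w : V → V → ℝ) (hsym : ∀ u v, w u v = w v u)
    (E : Finset (Sym2 V)) (hE : ∀ u v, u ≠ v → s(u, v) ∉ E → w u v = 0)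
    {S : Finset (Sym2 V)} (hSE : S ⊆ E) {X : Finset V} {k : ℕ} (hk : S.card + X.card + 1 = k)
    (s : V) :
    (if (endpoints S ∪ X).card = 2 * S.card + X.card then
      if s ∈ endpoints S ∪ X then 0 else lapMinor w (insert s (endpoints S ∪ X)) else 0) =
    ∑ F ∈ E.powerset with (F.card + k = Fintype.card V ∧ S ⊆ F ∧
        SpansFrom F (insert s (endpoints S ∪ X))),
      ∏ e ∈ F \ S, Sym2.lift ⟨w, hsym⟩ e := by
  set A := endpoints S ∪ X with hA
  have hend : ∀ e ∈ S, ∀ v ∈ e, v ∈ insert s A := fun e he v hv =>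
    Finset.mem_insert_of_mem (Finset.mem_union_left _ (mem_endpoints.2 ⟨e, he, hv⟩))
  have hAle : A.card ≤ 2 * S.card + X.card :=
    (Finset.card_union_le _ _).trans (Nat.add_le_add_right (card_endpoints_le S) _)
  by_cases hgood : A.card = 2 * S.card + X.card ∧ s ∉ A
  · rw [if_pos hgood.1, if_neg hgood.2, lapMinor_eq_sum w hsym E hE]
    have hc := Finset.card_insert_of_notMem hgood.2
    have hdisj : ∀ T : Finset (Sym2 V), T.card + (insert s A).card = Fintype.card V →
        SpansFrom T (insert s A) → Disjoint T S := by
      intro T hT hsp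
      rw [Finset.disjoint_left]
      intro e heT heS
      have h1 := (hsp.erase (hend e heS)).card_le
      have h2 := Finset.card_erase_lt_of_mem heT
      omega
    refine Finset.sum_bij' (fun T _ => T ∪ S) (fun F _ => F \ S) ?_ ?_ ?_ ?_ ?_
    · intro T hT
      simp only [Finset.mem_filter, Finset.mem_powerset] at hT ⊢
      have h1 := Finset.card_union_of_disjoint (hdisj T hT.2.1 hT.2.2)
      exact ⟨Finset.union_subset hT.1 hSE, by omega, Finset.subset_union_right,
        hT.2.2.mono_left Finset.subset_union_left⟩
    · intro F hF
      simp only [Finset.mem_filter, Finset.mem_powerset] at hF ⊢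
      obtain ⟨hFE, hFk, hSF, hsp⟩ := hF
      have h1 := Finset.card_sdiff_add_card_eq_card hSF
      exact ⟨Finset.sdiff_subset.trans hFE, by omega, hsp.sdiff hend⟩
    · intro T hT
      simp only [Finset.mem_filter] at hT
      exact Finset.union_sdiff_cancel_right (hdisj T hT.2.1 hT.2.2)
    · intro F hF
      simp only [Finset.mem_filter] at hF
      exact Finset.sdiff_union_of_subset hF.2.2.1
    · intro T hT
      simp only [Finset.mem_filter] at hT
      rw [Finset.union_sdiff_cancel_right (hdisj T hT.2.1 hT.2.2)]
  · rw [Finset.sum_eq_zero]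
    · split_ifs <;> tauto
    · intro F hF
      simp only [Finset.mem_filter] at hF
      obtain ⟨-, hFk, hSF, hsp⟩ := hF
      exfalso
      have h1 := Finset.card_sdiff_add_card_eq_card hSF
      have h2 := (hsp.sdiff hend).card_le
      refine hgood ⟨?_, fun hs => ?_⟩
      · have := Finset.card_insert_le s A
        omega
      · rw [Finset.insert_eq_of_mem hs] at h2
        omega

end Endpoints

/-- **Forest formula** (Liu–Chow / Myrvold): for `k ≥ 1`,
`F_k(G) = F₁(G) · Σ_{h=0}^{k-1} (−1)^h Σ w(e₁)⋯w(e_h) · det M`, where the inner sum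
is over sets of `h` distinct edges together with sets of `k−1−h` distinct vertices,
and `M` is the submatrix of the Green's function indexed by the `2h` endpoints of the
edges together with the `k−1−h` vertices, with `det M = 0` when these `2h + (k−1−h)`
indices are not pairwise distinct. -/
theorem stmt_4 {V : Type*} [Fintype V] [DecidableEq V]
    (hV : 1 < Fintype.card V)
    (w : V → V → ℝ) (hsym : ∀ u v, w u v = w v u)
    (hw : ∀ u v, 0 ≤ w u v) (hw0 : ∀ v, w v v = 0)
    (G : SimpleGraph V) (hG : ∀ u v, G.Adj u v ↔ u ≠ v ∧ 0 < w u v)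
    (hconn : G.Connected) (s : V) (k : ℕ) (hk : 1 ≤ k) :
    forestSum w hsym G k
      = forestSum w hsym G 1 *
        ∑ h ∈ Finset.range k, (-1 : ℝ) ^ h *
          ∑ Es ∈ Finset.powersetCard h G.edgeFinset,
            ∑ Xs ∈ Finset.powersetCard (k - 1 - h) (Finset.univ : Finset V),
              (∏ e ∈ Es, Sym2.lift ⟨w, hsym⟩ e) *
              (if (endpoints Es ∪ Xs).card = 2 * h + (k - 1 - h)
                then (Matrix.of fun a b : {x : V // x ∈ endpoints Es ∪ Xs} =>
                        green w s (a : V) (b : V)).det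
                else 0) := by
  set E := G.edgeFinset with hEdef
  set W : Sym2 V → ℝ := Sym2.lift ⟨w, hsym⟩ with hW
  have hE : ∀ e, e ∈ E ↔ e ∈ G.edgeSet := fun e => SimpleGraph.mem_edgeFinset
  have hzero : ∀ u v, u ≠ v → s(u, v) ∉ E → w u v = 0 := by
    intro u v huv he
    rw [hE, SimpleGraph.mem_edgeSet, hG] at he
    exact le_antisymm (not_lt.1 fun h => he ⟨huv, h⟩) (hw u v)
  have hpos : ∀ e ∈ E, 0 < W e := by
    intro e he
    induction e with | _ u v
    rw [hE, SimpleGraph.mem_edgeSet, hG] at he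
    exact he.2
  have hne := (lapMinor_singleton_pos w hsym G E hE hzero hpos hconn s).ne'
  rw [forestSum_one w hsym G E hE hzero s, forestSum_eq_sum w hsym G E hE s]
  have hright : ∀ h ∈ Finset.range k, ∀ S ∈ Finset.powersetCard h E,
      ∀ X ∈ Finset.powersetCard (k - 1 - h) (Finset.univ : Finset V),
      lapMinor w {s} * ((-1 : ℝ) ^ h * ((∏ e ∈ S, W e) *
        (if (endpoints S ∪ X).card = 2 * h + (k - 1 - h)
          then (Matrix.of fun a b : {x : V // x ∈ endpoints S ∪ X} =>
                  green w s (a : V) (b : V)).det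
          else 0))) =
      ∑ F ∈ E.powerset with (F.card + k = Fintype.card V ∧ S ⊆ F ∧
        SpansFrom F (insert s (endpoints S ∪ X))), (-1 : ℝ) ^ S.card * ∏ e ∈ F, W e := by
    intro h hh S hS X hX
    rw [Finset.mem_range] at hh
    obtain ⟨hSE, rfl⟩ := Finset.mem_powersetCard.1 hS
    obtain ⟨-, hX⟩ := Finset.mem_powersetCard.1 hX
    have h1 := lapMinor_mul_det_green w s hne (endpoints S ∪ X)
    have h2 := ite_lapMinor_eq_sum w hsym E hzero hSE (X := X) (k := k) (by omega) s
    rw [← h1, hX] at h2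
    calc _ = (-1 : ℝ) ^ S.card * ((∏ e ∈ S, W e) *
        (if (endpoints S ∪ X).card = 2 * S.card + (k - 1 - S.card)
          then lapMinor w {s} * (Matrix.of fun a b : {x : V // x ∈ endpoints S ∪ X} =>
                  green w s (a : V) (b : V)).det
          else 0)) := by
          split_ifs
          · ring
          · simp
      _ = _ := by
          rw [h2, Finset.mul_sum, Finset.mul_sum]
          refine Finset.sum_congr rfl fun F hF => ?_
          simp only [Finset.mem_filter] at hF
          rw [mul_comm (∏ e ∈ S, W e), Finset.prod_sdiff hF.2.2.1]
  have hleft : ∑ F ∈ E.powerset with (F.card + k = Fintype.card V ∧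
        ∃ R : Finset V, s ∈ R ∧ R.card = k ∧ SpansFrom F R), ∏ e ∈ F, W e =
      ∑ F ∈ E.powerset with F.card + k = Fintype.card V, ∑ S ∈ F.powerset,
        ∑ X : Finset V with (S.card + X.card + 1 = k ∧
          SpansFrom F (insert s (endpoints S ∪ X))), (-1 : ℝ) ^ S.card * ∏ e ∈ F, W e := by
    rw [← Finset.filter_filter, Finset.sum_filter]
    refine Finset.sum_congr rfl fun F hF => ?_
    have h1 := congrArg (Int.cast : ℤ → ℝ)
      (sum_neg_one_pow_card_eq_ite F s k hk (Finset.mem_filter.1 hF).2)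
    push_cast at h1
    simp_rw [← Finset.sum_mul]
    rw [h1]
    split_ifs <;> simp
  rw [hleft]
  calc _ = ∑ S ∈ E.powerset, ∑ F ∈ E.powerset with (F.card + k = Fintype.card V ∧ S ⊆ F),
        ∑ X : Finset V with (S.card + X.card + 1 = k ∧
          SpansFrom F (insert s (endpoints S ∪ X))), (-1 : ℝ) ^ S.card * ∏ e ∈ F, W e := by
        refine Finset.sum_comm' fun F S => ?_
        simp only [Finset.mem_filter, Finset.mem_powerset]
        exact ⟨fun h => ⟨⟨h.1.1, h.1.2, h.2⟩, h.2.trans h.1.1⟩,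
          fun h => ⟨⟨h.1.1, h.1.2.1⟩, h.1.2.2⟩⟩
    _ = ∑ S ∈ E.powerset, ∑ X : Finset V with S.card + X.card + 1 = k,
        ∑ F ∈ E.powerset with (F.card + k = Fintype.card V ∧ S ⊆ F ∧
          SpansFrom F (insert s (endpoints S ∪ X))), (-1 : ℝ) ^ S.card * ∏ e ∈ F, W e := by
        refine Finset.sum_congr rfl fun S _ => Finset.sum_comm' fun F X => ?_
        simp only [Finset.mem_filter, Finset.mem_univ, true_and]
        tauto
    _ = ∑ S ∈ E.powerset with S.card < k, ∑ X : Finset V with S.card + X.card + 1 = k,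
        ∑ F ∈ E.powerset with (F.card + k = Fintype.card V ∧ S ⊆ F ∧
          SpansFrom F (insert s (endpoints S ∪ X))), (-1 : ℝ) ^ S.card * ∏ e ∈ F, W e := by
        symm
        refine Finset.sum_subset (Finset.filter_subset _ _) fun S hS hSk => ?_
        rw [Finset.sum_eq_zero]
        intro X hX
        simp only [Finset.mem_filter, Finset.mem_univ, true_and] at hX hSk
        exact absurd ⟨hS, by omega⟩ hSk
    _ = _ := by
        rw [← Finset.sum_fiberwise_of_maps_to (t := Finset.range k) (g := Finset.card)
          (fun S hS => Finset.mem_range.2 (Finset.mem_filter.1 hS).2), Finset.mul_sum]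
        refine Finset.sum_congr rfl fun h hh => ?_
        have hh' := Finset.mem_range.1 hh
        rw [Finset.mul_sum, Finset.mul_sum]
        refine Finset.sum_congr ?_ fun S hS => ?_
        · ext S
          simp only [Finset.mem_filter, Finset.mem_powerset, Finset.mem_powersetCard]
          exact ⟨fun h => ⟨h.1.1, h.2⟩, fun h => ⟨⟨h.1, by omega⟩, h.2⟩⟩
        · rw [Finset.mul_sum, Finset.mul_sum]
          have hSh := (Finset.mem_powersetCard.1 hS).2
          refine Finset.sum_congr ?_ fun X hX => (hright h hh S hS X hX).symm
          ext X
          simp only [Finset.mem_filter, Finset.mem_univ, true_and, Finset.mem_powersetCard,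
            Finset.subset_univ]
          omega
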